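/- arXiv:0711.0445 — 3 statements merged into one kernel-verified Lean document; each statement's English description precedes it below -/
import Mathlib

section
/- Let p be a prime, h ≥ 1 an integer, and n = p^h. The genus of the numerical semigroup generated by the three integers n^3 − n^2 + n, n^3, n^3 + 1, that is, the number of natural numbers not lying in the additive submonoid of ℕ generated by {n^3 − n^2 + n, n^3, n^3 + 1}, equals (n^3 + 1)(n^2 − 2)/2 + 1; equivalently, twice this number equals (n^3 + 1)(n^2 − 2) + 2. -/
/-- A symmetric set of natural numbers whose largest gap is `F` has `(F + 1) / 2` gaps. -/
theorem two_mul_ncard_compl_of_symmetric (S : Set ℕ) (F : ℕ)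
    (hsymm : ∀ m ≤ F, (m ∈ S ↔ F - m ∉ S)) (hlarge : ∀ m, F < m → m ∈ S) :
    2 * Set.ncard {m : ℕ | m ∉ S} = F + 1 := by
  classical
  have hgaps : {m : ℕ | m ∉ S} = ((Finset.range (F + 1)).filter (· ∉ S) : Finset ℕ) := by
    ext m
    simp only [Set.mem_ofPred_eq, Finset.coe_filter, Finset.mem_range]
    exact ⟨fun hm => ⟨by by_contra hF; exact hm (hlarge m (by omega)), hm⟩, fun hm => hm.2⟩
  have hreflect : ((Finset.range (F + 1)).filter (· ∈ S)).card =
      ((Finset.range (F + 1)).filter (· ∉ S)).card := by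
    refine Finset.card_bij' (fun m _ => F - m) (fun m _ => F - m) ?_ ?_ ?_ ?_
    · intro m hm
      simp only [Finset.mem_filter, Finset.mem_range] at hm ⊢
      exact ⟨by omega, (hsymm m (by omega)).1 hm.2⟩
    · intro m hm
      simp only [Finset.mem_filter, Finset.mem_range] at hm ⊢
      refine ⟨by omega, (hsymm (F - m) (by omega)).2 ?_⟩
      rw [Nat.sub_sub_self (by omega)]
      exact hm.2
    · intro m hm
      simp only [Finset.mem_filter, Finset.mem_range] at hm
      omega
    · intro m hm
      simp only [Finset.mem_filter, Finset.mem_range] at hm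
      omega
  have hcard := Finset.card_filter_add_card_filter_not (s := Finset.range (F + 1)) (· ∈ S)
  rw [Finset.card_range] at hcard
  rw [hgaps, Set.ncard_coe_finset]
  omega

theorem AddSubmonoid.mem_closure_triple_nat {x y z m : ℕ} :
    m ∈ AddSubmonoid.closure ({x, y, z} : Set ℕ) ↔
      ∃ a b c : ℕ, m = a * x + b * y + c * z := by
  constructor
  · intro hm
    induction hm using AddSubmonoid.closure_induction with
    | mem w hw =>
      rcases hw with rfl | rfl | rfl
      · exact ⟨1, 0, 0, by ring⟩
      · exact ⟨0, 1, 0, by ring⟩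
      · exact ⟨0, 0, 1, by ring⟩
    | zero => exact ⟨0, 0, 0, by ring⟩
    | add u v _ _ hu hv =>
      obtain ⟨a, b, c, rfl⟩ := hu
      obtain ⟨a', b', c', rfl⟩ := hv
      exact ⟨a + a', b + b', c + c', by ring⟩
  · rintro ⟨a, b, c, rfl⟩
    simp only [← smul_eq_mul]
    refine add_mem (add_mem ?_ ?_) ?_ <;>
      exact nsmul_mem (AddSubmonoid.subset_closure (by simp)) _

/-- Every integer has a normal form with respect to the three generators. -/
theorem exists_normal_form {n : ℤ} (hn : 0 < n) (m : ℤ) :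
    ∃ k i j : ℤ, 0 ≤ k ∧ k < n ∧ 0 ≤ i ∧ i < n ^ 2 ∧
      m = i * (n ^ 3 - n ^ 2 + n) + j * n ^ 3 + k * (n ^ 3 + 1) := by
  have hm := Int.emod_add_mul_ediv m n
  set k := m % n
  set s := m / n - k * n ^ 2 with hs
  have hi := Int.emod_add_mul_ediv (s * (n + 1)) (n ^ 2)
  set i := s * (n + 1) % n ^ 2
  set t := s * (n + 1) / n ^ 2
  refine ⟨k, i, -s * n + t * (n ^ 2 - n + 1), Int.emod_nonneg _ hn.ne', Int.emod_lt_of_pos _ hn,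
    Int.emod_nonneg _ (by positivity), Int.emod_lt_of_pos _ (by positivity), ?_⟩
  linear_combination (-(n ^ 3 - n ^ 2 + n)) * hi - hm - n * hs

theorem nonneg_of_dvd_sub {N x y : ℤ} (hN : 0 < N) (hx : 0 ≤ x) (hy : y < N) (h : N ∣ x - y) :
    ∃ v : ℤ, 0 ≤ v ∧ x = y + N * v := by
  obtain ⟨v, hv⟩ := h
  refine ⟨v, ?_, by linarith⟩
  by_contra! hneg
  nlinarith

/-- An integer in normal form is a nonnegative combination of the generators exactly when its
coefficient of `n ^ 3` is nonnegative. -/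
theorem nonneg_combination_iff {n : ℤ} (hn : 0 < n) {k i j : ℤ}
    (hk : 0 ≤ k) (hkn : k < n) (hi : 0 ≤ i) (hin : i < n ^ 2) :
    (∃ a b c : ℤ, 0 ≤ a ∧ 0 ≤ b ∧ 0 ≤ c ∧
      i * (n ^ 3 - n ^ 2 + n) + j * n ^ 3 + k * (n ^ 3 + 1) =
        a * (n ^ 3 - n ^ 2 + n) + b * n ^ 3 + c * (n ^ 3 + 1)) ↔ 0 ≤ j := by
  refine ⟨?_, fun hj => ⟨i, j, k, hi, hj, hk, rfl⟩⟩
  rintro ⟨a, b, c, ha, hb, hc, heq⟩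
  obtain ⟨u, hu, rfl⟩ := nonneg_of_dvd_sub hn hc hkn
    ⟨(i - a) * (n ^ 2 - n + 1) + (j - b) * n ^ 2 + (k - c) * n ^ 2,
      by linear_combination -heq⟩
  have hdiv : (u * (n + 1) + a - i) * (n ^ 2 - n + 1) = (j - b) * n ^ 2 := by
    apply mul_left_cancel₀ hn.ne'
    linear_combination -heq
  obtain ⟨v, hv, hvi⟩ := nonneg_of_dvd_sub (x := u * (n + 1) + a) (by positivity) (by positivity) hin
    ⟨(j - b) * (n + 1) - n * (u * (n + 1) + a - i), by linear_combination (n + 1) * hdiv⟩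
  have hj : j - b = v * (n ^ 2 - n + 1) := by
    apply mul_right_cancel₀ (pow_ne_zero 2 hn.ne')
    linear_combination -hdiv + (n ^ 2 - n + 1) * hvi
  have : 0 ≤ v * (n ^ 2 - n + 1) := mul_nonneg hv (by nlinarith)
  linarith

theorem mem_closure_iff_normal_form {n : ℕ} (hn : 0 < n) {k i j : ℤ}
    (hk : 0 ≤ k) (hkn : k < n) (hi : 0 ≤ i) (hin : i < n ^ 2) {m : ℕ}
    (hm : (m : ℤ) = i * (n ^ 3 - n ^ 2 + n) + j * n ^ 3 + k * (n ^ 3 + 1)) :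
    m ∈ AddSubmonoid.closure ({n ^ 3 - n ^ 2 + n, n ^ 3, n ^ 3 + 1} : Set ℕ) ↔ 0 ≤ j := by
  have hcast : ((n ^ 3 - n ^ 2 + n : ℕ) : ℤ) = (n : ℤ) ^ 3 - n ^ 2 + n := by
    push_cast [Nat.cast_sub (Nat.pow_le_pow_right hn (by norm_num : 2 ≤ 3))]
    ring
  rw [← nonneg_combination_iff (by exact_mod_cast hn) hk hkn hi hin, ← hm,
    AddSubmonoid.mem_closure_triple_nat]
  constructor
  · rintro ⟨a, b, c, h⟩
    refine ⟨a, b, c, by positivity, by positivity, by positivity, ?_⟩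
    rw [← hcast]
    exact_mod_cast h
  · rintro ⟨a, b, c, ha, hb, hc, h⟩
    lift a to ℕ using ha
    lift b to ℕ using hb
    lift c to ℕ using hc
    refine ⟨a, b, c, ?_⟩
    rw [← hcast] at h
    exact_mod_cast h

theorem stmt_10 (p : ℕ) (hp : p.Prime) (h : ℕ) (hh : 1 ≤ h) (n : ℕ) (hn : n = p ^ h) :
    2 * Set.ncard {m : ℕ |
        m ∉ AddSubmonoid.closure ({n ^ 3 - n ^ 2 + n, n ^ 3, n ^ 3 + 1} : Set ℕ)} =
      (n ^ 3 + 1) * (n ^ 2 - 2) + 2 := by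
  have hn2 : 2 ≤ n := by
    rw [hn]
    exact hp.two_le.trans (Nat.le_self_pow (by omega) p)
  have hpos : (0 : ℤ) < n := by exact_mod_cast (by omega : 0 < n)
  have hF : (((n ^ 3 + 1) * (n ^ 2 - 2) + 1 : ℕ) : ℤ) = ((n : ℤ) ^ 3 + 1) * (n ^ 2 - 2) + 1 := by
    push_cast [Nat.cast_sub (show 2 ≤ n ^ 2 by nlinarith)]
    ring
  refine two_mul_ncard_compl_of_symmetric
    (AddSubmonoid.closure ({n ^ 3 - n ^ 2 + n, n ^ 3, n ^ 3 + 1} : Set ℕ) : Set ℕ)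
    ((n ^ 3 + 1) * (n ^ 2 - 2) + 1) ?_ ?_
  · intro m hm
    obtain ⟨k, i, j, hk, hkn, hi, hin, hmk⟩ := exists_normal_form hpos m
    rw [SetLike.mem_coe, SetLike.mem_coe,
      mem_closure_iff_normal_form (by omega) hk hkn hi hin hmk,
      mem_closure_iff_normal_form (k := n - 1 - k) (i := n ^ 2 - 1 - i) (j := -1 - j) (by omega)
        (by omega) (by omega) (by omega) (by omega)
        (by rw [Nat.cast_sub hm, hF]; linear_combination -hmk)]
    omega
  · intro m hm
    obtain ⟨k, i, j, hk, hkn, hi, hin, hmk⟩ := exists_normal_form hpos m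
    rw [SetLike.mem_coe, mem_closure_iff_normal_form (by omega) hk hkn hi hin hmk]
    by_contra! hj
    have hm' : ((n : ℤ) ^ 3 + 1) * (n ^ 2 - 2) + 1 < m := by
      rw [← hF]
      exact_mod_cast hm
    have h₁ : i * ((n : ℤ) ^ 3 - n ^ 2 + n) ≤ (n ^ 2 - 1) * (n ^ 3 - n ^ 2 + n) :=
      mul_le_mul_of_nonneg_right (by omega)
        (by nlinarith [mul_nonneg hpos.le (sq_nonneg ((n : ℤ) - 1))])
    have h₂ : j * (n : ℤ) ^ 3 ≤ -1 * n ^ 3 := mul_le_mul_of_nonneg_right (by omega) (by positivity)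
    have h₃ : k * ((n : ℤ) ^ 3 + 1) ≤ (n - 1) * (n ^ 3 + 1) :=
      mul_le_mul_of_nonneg_right (by omega) (by positivity)
    linarith
end

section
/- For every integer n ≥ 3 there is no positive integer m satisfying both m·(n^3 + 1)·(n^2 − 2) ≤ n^6 − n^3 − 2 and n^9 + 1 ≤ m·(n^8 − n^6 + n^5 + 1). (This is the numerical core of the proof that for q = n^3 > 8 the curve 𝒳 is not 𝔽_{q^2}-covered by the Hermitian curve over 𝔽_{q^2}: the first inequality is the Hurwitz genus bound forcing the covering degree m to satisfy m ≤ n, the second is the rational-point count forcing m > n.) -/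
theorem stmt_12 (n : ℕ) (hn : 3 ≤ n) :
    ¬ ∃ m : ℕ, 0 < m ∧
        m * (n ^ 3 + 1) * (n ^ 2 - 2) ≤ n ^ 6 - n ^ 3 - 2 ∧
        n ^ 9 + 1 ≤ m * (n ^ 8 - n ^ 6 + n ^ 5 + 1) := by
  rintro ⟨m, -, hgenus, hpoints⟩
  have h2 : 2 ≤ n ^ 2 := by nlinarith
  have h3 : 2 ≤ n ^ 3 := by nlinarith
  have h86 : n ^ 6 ≤ n ^ 8 := Nat.pow_le_pow_right (by omega) (by norm_num)
  have hfactor : n ^ 6 - n ^ 3 - 2 = (n ^ 3 + 1) * (n ^ 3 - 2) := by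
    obtain ⟨c, hc⟩ := Nat.exists_eq_add_of_le h3
    have h6 : n ^ 6 = n ^ 3 + 2 + (n ^ 3 + 1) * c := by
      rw [show n ^ 6 = n ^ 3 * n ^ 3 by ring, hc]
      ring
    rw [h6, show n ^ 3 - 2 = c by omega]
    omega
  have hgenus' : m * (n ^ 2 - 2) ≤ n ^ 3 - 2 := by
    rw [hfactor] at hgenus
    refine Nat.le_of_mul_le_mul_left ?_ (Nat.succ_pos (n ^ 3))
    calc (n ^ 3 + 1) * (m * (n ^ 2 - 2)) = m * (n ^ 3 + 1) * (n ^ 2 - 2) := by ring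
      _ ≤ _ := hgenus
  have hmn : m ≤ n := by
    by_contra! h
    have hle : (n + 1) * (n ^ 2 - 2) ≤ n ^ 3 - 2 :=
      (Nat.mul_le_mul_right _ h).trans hgenus'
    zify [h2, h3] at hle hn
    nlinarith
  have hle : n ^ 9 + 1 ≤ n * (n ^ 8 - n ^ 6 + n ^ 5 + 1) :=
    hpoints.trans (Nat.mul_le_mul_right _ hmn)
  have h6 : n ≤ n ^ 6 := Nat.le_self_pow (by norm_num) n
  have h7 : 3 * n ^ 6 ≤ n ^ 7 := by
    rw [pow_succ n 6, mul_comm]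
    exact Nat.mul_le_mul_left _ hn
  zify [h86] at hle h6 h7
  ring_nf at hle h6 h7
  linarith
end

section
/- Let n ≥ 2 and d ≥ 7 be integers with d dividing n^2 − n + 1. Then d·n^3·(n^3 + 1)·(n^2 − 1)·(n^2 − n + 1) > 6·((n^3 + 1)·(n^2 − d − 1) + 2d)^2. (Equivalently, the quotient curve 𝒳₁ = 𝒳/C_d of genus g₁ = ((n^3+1)(n^2−d−1)/d + 2)/2 admits the automorphism group G₁ = Aut(𝒳)/C_d of order n^3(n^3+1)(n^2−1)(n^2−n+1)/d, and |G₁| > 24·g₁².) -/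
/-- A concave quadratic that is positive at both ends of an interval is positive on it. -/
theorem quadratic_pos_of_endpoints {a b d X P Q : ℤ} (had : a ≤ d) (hdb : d ≤ b)
    (ha : 0 < a * X - 6 * (P - a * Q) ^ 2) (hb : 0 < b * X - 6 * (P - b * Q) ^ 2) :
    0 < d * X - 6 * (P - d * Q) ^ 2 := by
  rcases had.eq_or_lt with rfl | had'
  · exact ha
  have hab : 0 < b - a := by linarith
  have key : (d * X - 6 * (P - d * Q) ^ 2) * (b - a) =
      (b - d) * (a * X - 6 * (P - a * Q) ^ 2) + (d - a) * (b * X - 6 * (P - b * Q) ^ 2) +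
        6 * Q ^ 2 * ((d - a) * (b - d) * (b - a)) := by ring
  have h₁ : 0 ≤ b - d := by linarith
  have h₂ : 0 < d - a := by linarith
  refine pos_of_mul_pos_left ?_ hab.le
  rw [key]
  positivity

theorem stmt_14 (n d : ℤ) (hn : 2 ≤ n) (hd : 7 ≤ d) (hdvd : d ∣ n ^ 2 - n + 1) :
    d * n ^ 3 * (n ^ 3 + 1) * (n ^ 2 - 1) * (n ^ 2 - n + 1) >
      6 * ((n ^ 3 + 1) * (n ^ 2 - d - 1) + 2 * d) ^ 2 := by
  have hdm : d ≤ n ^ 2 - n + 1 := Int.le_of_dvd (by nlinarith) hdvd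
  have hn3 : 3 ≤ n := by nlinarith
  obtain ⟨k, hk, rfl⟩ : ∃ k : ℤ, 0 ≤ k ∧ n = k + 3 := ⟨n - 3, by linarith, by ring⟩
  have h := quadratic_pos_of_endpoints (X := (k + 3) ^ 3 * ((k + 3) ^ 3 + 1) * ((k + 3) ^ 2 - 1) *
    ((k + 3) ^ 2 - (k + 3) + 1)) (P := ((k + 3) ^ 3 + 1) * ((k + 3) ^ 2 - 1))
    (Q := (k + 3) ^ 3 - 1) hd hdm ?_ ?_
  · linarith
  · ring_nf
    positivity
  · ring_nf
    positivity
end
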